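/- Let D, n be positive integers, C : Fin D → Fin D → Matrix (Fin n) (Fin n) ℂ a family of matrices, and c ∈ ℂ with c ≠ 0. Assume that for every L ≥ 1 and all tuples i, j : Fin L → Fin D one has trace(C^(i₁j₁)·C^(i₂j₂)⋯C^(i_L j_L)) = c^L · ∏_l (if i_l = j_l then 1 else 0). Then the matrix T := (c·D)⁻¹ • ∑_{i ∈ Fin D} C^(ii) has characteristic polynomial X^(n−1)·(X − 1); in particular the spectrum of T is contained in {0,1} and the eigenvalue 1 is nondegenerate (algebraic multiplicity one). -/

import Mathlib

open Polynomial Matrix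

/-- Over a domain of characteristic zero, a multiset is determined by its power sums. -/
theorem Multiset.eq_of_forall_sum_map_pow_eq {R : Type*} [CommRing R] [IsDomain R] [CharZero R]
    {s t : Multiset R}
    (h : ∀ k : ℕ, (s.map (· ^ k)).sum = (t.map (· ^ k)).sum) : s = t := by
  classical
  have hpoly (p : R[X]) : (s.map fun x => p.eval x).sum = (t.map fun x => p.eval x).sum := by
    induction p using Polynomial.induction_on' with
    | add p q hp hq => simp [Multiset.sum_map_add, hp, hq]
    | monomial k a => simp [Multiset.sum_map_mul_left, h k]
  ext a
  let p : R[X] := ∏ x ∈ (s + t).toFinset.erase a, (X - Polynomial.C x)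
  have hpa : p.eval a ≠ 0 := by
    simp only [p, eval_prod, eval_sub, eval_X, eval_C, Finset.prod_ne_zero_iff, sub_ne_zero]
    exact fun x hx => (Finset.ne_of_mem_erase hx).symm
  have hcount (u : Multiset R) (hu : u ≤ s + t) :
      (u.map fun x => p.eval x).sum = u.count a * p.eval a := by
    rw [Finset.sum_multiset_map_count, Finset.sum_eq_single a, nsmul_eq_mul]
    · intro b hb hba
      have hroot : p.eval b = 0 := by
        simp only [p, eval_prod, eval_sub, eval_X, eval_C]
        refine Finset.prod_eq_zero (i := b) ?_ (sub_self b)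
        exact Finset.mem_erase.2
          ⟨hba, Multiset.mem_toFinset.2 (Multiset.mem_of_le hu (Multiset.mem_toFinset.1 hb))⟩
      rw [hroot, smul_zero]
    · intro ha
      rw [Multiset.count_eq_zero_of_notMem (by simpa using ha), zero_smul]
  have key := hpoly p
  rw [hcount s (Multiset.le_add_right s t), hcount t (Multiset.le_add_left t s)] at key
  exact_mod_cast mul_right_cancel₀ hpa key

section Charpoly

variable {K m : Type*} [Field K] [IsAlgClosed K] [Fintype m] [DecidableEq m]

/-- The determinant of a polynomial in `A` is the product of its values at the eigenvalues. -/
theorem Matrix.det_aeval_eq_prod_roots_charpoly (A : Matrix m m K) (p : K[X]) :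
    (aeval A p).det = (A.charpoly.roots.map fun x => p.eval x).prod := by
  have hcard : A.charpoly.roots.card = Fintype.card m := by
    rw [← (IsAlgClosed.splits A.charpoly).natDegree_eq_card_roots, charpoly_natDegree_eq_dim]
  have hlin (a : K) : (A - algebraMap K _ a).det = (A.charpoly.roots.map (· - a)).prod := by
    have h := (IsAlgClosed.splits A.charpoly).eval_eq_prod_roots_of_monic A.charpoly_monic a
    rw [eval_charpoly] at h
    rw [← neg_sub, det_neg, ← hcard, Matrix.algebraMap_eq_diagonal]
    change _ * (Matrix.scalar m a - A).det = _
    rw [h, ← Multiset.card_map (a - ·), ← Multiset.prod_map_neg, Multiset.map_map]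
    simp
  rw [(IsAlgClosed.splits p).eq_prod_roots]
  induction p.roots using Multiset.induction with
  | empty => simp [Matrix.algebraMap_eq_diagonal, hcard]
  | cons a u ih =>
    rw [Multiset.map_cons, Multiset.prod_cons, mul_left_comm, map_mul, det_mul, ih]
    simp [Multiset.prod_map_mul, hlin]

/-- The eigenvalues of `q(A)` are the values of `q` at the eigenvalues of `A`. -/
theorem Matrix.charpoly_aeval_eq_prod (A : Matrix m m K) (q : K[X]) :
    (aeval A q).charpoly = (A.charpoly.roots.map fun x => X - Polynomial.C (q.eval x)).prod := by
  refine Polynomial.funext fun x => ?_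
  have h := A.det_aeval_eq_prod_roots_charpoly (Polynomial.C x - q)
  rw [eval_charpoly, eval_multiset_prod, Multiset.map_map]
  simpa [Matrix.scalar_apply, Matrix.algebraMap_eq_diagonal, Pi.algebraMap_def] using h

theorem Matrix.trace_pow_eq_sum_roots_charpoly (A : Matrix m m K) (k : ℕ) :
    (A ^ k).trace = (A.charpoly.roots.map (· ^ k)).sum := by
  have h := A.charpoly_aeval_eq_prod (X ^ k)
  simp only [map_pow, aeval_X, eval_pow, eval_X] at h
  rw [trace_eq_sum_roots_charpoly, h]
  have := roots_multiset_prod_X_sub_C (A.charpoly.roots.map (· ^ k))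
  rw [Multiset.map_map] at this
  rw [← this]
  simp

end Charpoly

theorem Finset.sum_pow_eq_sum_prod_ofFn {R ι : Type*} [Semiring R] [Fintype ι] (f : ι → R)
    (k : ℕ) :
    (∑ i, f i) ^ k = ∑ g : Fin k → ι, (List.ofFn fun l => f (g l)).prod := by
  induction k with
  | zero => simp
  | succ k ih =>
    rw [pow_succ', ih, Finset.sum_mul_sum, ← Fintype.sum_prod_type',
      ← (Fin.consEquiv fun _ => ι).sum_comp]
    simp [Fin.consEquiv, List.ofFn_succ]

/-- Proposition 1 of the paper (general `k`, with `C` the composed MPO tensor): if the MPO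
generated by `C` equals `c^L` times the identity MPO for every length `L ≥ 1`, then the
transfer matrix `(c·D)⁻¹ • ∑_i C^(ii)` has characteristic polynomial `X^(n-1)·(X - 1)`. -/
theorem stmt_2 (D n : ℕ) (hD : 0 < D) (hn : 0 < n)
    (C : Fin D → Fin D → Matrix (Fin n) (Fin n) ℂ)
    (c : ℂ) (hc : c ≠ 0)
    (h : ∀ L : ℕ, 1 ≤ L → ∀ i j : Fin L → Fin D,
      ((List.ofFn fun l : Fin L => C (i l) (j l)).prod).trace
        = c ^ L * ∏ l : Fin L, (if i l = j l then (1 : ℂ) else 0)) :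
    ((c * (D : ℂ))⁻¹ • ∑ i : Fin D, C i i).charpoly
      = X ^ (n - 1) * (X - 1) := by
  have htrace (L : ℕ) (hL : 1 ≤ L) : (((c * (D : ℂ))⁻¹ • ∑ i : Fin D, C i i) ^ L).trace = 1 := by
    have hD' : (D : ℂ) ≠ 0 := Nat.cast_ne_zero.2 hD.ne'
    rw [_root_.smul_pow, Finset.sum_pow_eq_sum_prod_ofFn, trace_smul, trace_sum]
    simp only [fun i : Fin L → Fin D => h L hL i i, if_true, Finset.prod_const_one, mul_one,
      Finset.sum_const, Finset.card_univ, Fintype.card_pi, Fintype.card_fin, Finset.prod_const,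
      smul_eq_mul, nsmul_eq_mul]
    push_cast
    rw [inv_pow, mul_pow, mul_comm ((D : ℂ) ^ L)]
    exact inv_mul_cancel₀ (mul_ne_zero (pow_ne_zero _ hc) (pow_ne_zero _ hD'))
  set T := (c * (D : ℂ))⁻¹ • ∑ i : Fin D, C i i
  have hroots : T.charpoly.roots = 1 ::ₘ Multiset.replicate (n - 1) 0 := by
    refine Multiset.eq_of_forall_sum_map_pow_eq fun k => ?_
    rw [← T.trace_pow_eq_sum_roots_charpoly]
    rcases k.eq_zero_or_pos with rfl | hk
    · simp [Nat.cast_sub (Nat.succ_le_of_lt hn)]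
    · simp [htrace k hk, hk.ne']
  rw [(IsAlgClosed.splits T.charpoly).eq_prod_roots_of_monic T.charpoly_monic, hroots]
  simp [mul_comm]
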